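/- For any strictly increasing sequence of stopping times $\{\lambda_n\}$ and estimators $h_n(X_0,\dots,X_{\lambda_n})$ such that for all stationary ergodic binary Markov chains of arbitrary finite order, $\lambda_n/n\to1$ and $h_n(X_0,\dots,X_{\lambda_n})-K(X_0^{\lambda_n})\to 0$ almost surely, there exists a stationary ergodic finitarily Markovian binary process $\{X_n\}$ such that with positive probability $h_n(X_0,\dots,X_{\lambda_n})\ne K(X_{-\infty}^{\lambda_n})$ for infinitely many $n$. -/

import Mathlib

open MeasureTheory Filter Set
open scoped ENNReal

attribute [local instance] Classical.propDecidable

namespace MemoryEst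

variable {Ω : Type*} [MeasurableSpace Ω] {𝒳 : Type*} [MeasurableSpace 𝒳]

/-- The word `w` (read left to right) occupies positions `l - w.length + 1, …, l`. -/
def wordEndsAt (X : ℤ → Ω → 𝒳) (l : ℤ) (w : List 𝒳) (ω : Ω) : Prop :=
  ∀ j : Fin w.length, X (l - (w.length : ℤ) + 1 + ((j : ℕ) : ℤ)) ω = w.get j

def cyl (X : ℤ → Ω → 𝒳) (l : ℤ) (w : List 𝒳) : Set Ω := {ω | wordEndsAt X l w ω}

/-- `P(X_{-k+1}^0 = w)` where `k = w.length`. -/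
noncomputable def wordProb (μ : Measure Ω) (X : ℤ → Ω → 𝒳) (w : List 𝒳) : ℝ :=
  (μ (cyl X 0 w)).toReal

/-- `p(x | w) = P(X_1 = x | X_{-k+1}^0 = w)`. -/
noncomputable def condProb (μ : Measure Ω) (X : ℤ → Ω → 𝒳) (x : 𝒳) (w : List 𝒳) : ℝ :=
  (μ (cyl X 0 w ∩ {ω | X 1 ω = x})).toReal / wordProb μ X w

def IsStationary (μ : Measure Ω) (X : ℤ → Ω → 𝒳) : Prop :=
  ∀ (l : ℤ) (w : List 𝒳), μ (cyl X l w) = μ (cyl X 0 w)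

/-- `w` is a memory word: it has positive probability and the conditional law of the
next symbol does not change under any left extension of positive probability. -/
def IsMemoryWord (μ : Measure Ω) (X : ℤ → Ω → 𝒳) (w : List 𝒳) : Prop :=
  0 < wordProb μ X w ∧
    ∀ (z : List 𝒳) (y : 𝒳), z ≠ [] → 0 < wordProb μ X (z ++ w ++ [y]) →
      condProb μ X y w = condProb μ X y (z ++ w)

/-- The word `(X_{l-k+1}, …, X_l)`. -/
def pastWord (X : ℤ → Ω → 𝒳) (l : ℤ) (k : ℕ) (ω : Ω) : List 𝒳 :=
  (List.range k).map fun j => X (l - (k : ℤ) + 1 + (j : ℤ)) ω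

/-- `K(X_{-∞}^l)`: least `k` such that `X_{l-k+1}^l` is a memory word (`sInf ∅ = 0`). -/
noncomputable def memoryLenNat (μ : Measure Ω) (X : ℤ → Ω → 𝒳) (l : ℤ) (ω : Ω) : ℕ :=
  sInf {k : ℕ | IsMemoryWord μ X (pastWord X l k ω)}

def FinitarilyMarkovian (μ : Measure Ω) (X : ℤ → Ω → 𝒳) : Prop :=
  ∀ᵐ ω ∂μ, ∃ k : ℕ, IsMemoryWord μ X (pastWord X 0 k ω)

/-- Number of positions `l ∈ [a,b]` at which the word `w` ends. -/
noncomputable def countOcc (X : ℤ → Ω → 𝒳) (a b : ℤ) (w : List 𝒳) (ω : Ω) : ℕ :=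
  ((Finset.Icc a b).filter fun l => wordEndsAt X l w ω).card

/-- Empirical conditional probability `p̂_n(x|w)` from the data segment `X_{-n}^0`. -/
noncomputable def empP (X : ℤ → Ω → 𝒳) (n : ℕ) (x : 𝒳) (w : List 𝒳) (ω : Ω) : ℝ :=
  (countOcc X (-(n : ℤ) + w.length) 0 (w ++ [x]) ω : ℝ) /
    (countOcc X (-(n : ℤ) + w.length - 1) (-1) w ω : ℝ)

/-- `w ∈ 𝓛ⁿ_{w.length}`: the word `w` appears more than `n^{1-γ}` times in `X_{-n}^0`. -/
def memLong (γ : ℝ) (X : ℤ → Ω → 𝒳) (n : ℕ) (w : List 𝒳) (ω : Ω) : Prop :=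
  (n : ℝ) ^ (1 - γ) < (countOcc X (-(n : ℤ) + w.length - 1) 0 w ω : ℝ)

/-- Empirical discrepancy `Δ̂ⁿ_k(w)` (with `sSup ∅ = 0`). -/
noncomputable def empDelta (γ : ℝ) (X : ℤ → Ω → 𝒳) (n : ℕ) (w : List 𝒳) (ω : Ω) : ℝ :=
  sSup {d : ℝ | ∃ (z : List 𝒳) (x : 𝒳), 1 ≤ z.length ∧ z.length ≤ n ∧
    memLong γ X n (z ++ w ++ [x]) ω ∧
    d = |empP X n x w ω - empP X n x (z ++ w) ω|}

/-- The discrepancy `Δ_k(w)` measuring failure of `w` to be a memory word. -/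
noncomputable def Delta (μ : Measure Ω) (X : ℤ → Ω → 𝒳) (w : List 𝒳) : ℝ :=
  sSup {d : ℝ | ∃ (z : List 𝒳) (x : 𝒳), z ≠ [] ∧ 0 < wordProb μ X (z ++ w ++ [x]) ∧
    d = |condProb μ X x w - condProb μ X x (z ++ w)|}

def NTEST (γ β : ℝ) (X : ℤ → Ω → 𝒳) (n : ℕ) (w : List 𝒳) (ω : Ω) : Prop :=
  empDelta γ X n w ω ≤ (n : ℝ) ^ (-β)

/-- Forward recurrence times `λ⁺_{l,k,i}` of the word occupying `(l-k, l]`. -/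
noncomputable def lamPos (X : ℤ → Ω → 𝒳) (l : ℤ) (k : ℕ) (ω : Ω) : ℕ → ℕ
  | 0 => 0
  | i + 1 =>
    lamPos X l k ω i +
      sInf {t : ℕ | 0 < t ∧ ∀ j : Fin k,
        X (l + (lamPos X l k ω i : ℤ) + (t : ℤ) - ((j : ℕ) : ℤ)) ω =
          X (l + (lamPos X l k ω i : ℤ) - ((j : ℕ) : ℤ)) ω}

/-- Backward recurrence times `λ⁻_{l,k,i}` of the word occupying `(l-k, l]`. -/
noncomputable def lamNeg (X : ℤ → Ω → 𝒳) (l : ℤ) (k : ℕ) (ω : Ω) : ℕ → ℕ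
  | 0 => 0
  | i + 1 =>
    lamNeg X l k ω i +
      sInf {t : ℕ | 0 < t ∧ ∀ j : Fin k,
        X (l - (lamNeg X l k ω i : ℤ) - (t : ℤ) - ((j : ℕ) : ℤ)) ω =
          X (l - (lamNeg X l k ω i : ℤ) - ((j : ℕ) : ℤ)) ω}

/-- The left shift on two-sided path space. -/
def shift (𝒳 : Type*) : (ℤ → 𝒳) → (ℤ → 𝒳) := fun ω n => ω (n + 1)

/-- The canonical process on path space. -/
def proc (𝒳 : Type*) : ℤ → (ℤ → 𝒳) → 𝒳 := fun n ω => ω n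

/-- First order Markov property for the canonical process. -/
def MarkovOrderOne {S : Type*} [MeasurableSpace S] (μ : Measure (ℤ → S)) : Prop :=
  ∀ (w : List S) (a y : S), 0 < wordProb μ (proc S) (w ++ [a]) →
    condProb μ (proc S) y (w ++ [a]) = condProb μ (proc S) y [a]

/-- Markov chain of order `L`: every positive-probability word of length `L` is a memory word. -/
def MarkovOfOrder {S : Type*} [MeasurableSpace S] (μ : Measure (ℤ → S)) (L : ℕ) : Prop :=
  ∀ w : List S, w.length = L → 0 < wordProb μ (proc S) w → IsMemoryWord μ (proc S) w

/-- The forward recurrence times `ζ_n(i)` of the left-extension reconstruction scheme. -/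
noncomputable def zeta (X : ℤ → Ω → 𝒳) (i : ℕ) (ω : Ω) : ℕ → ℕ
  | 0 => 0
  | n + 1 =>
    zeta X i ω n +
      sInf {t : ℕ | 0 < t ∧ ∀ j : Fin (n + 1),
        X ((i : ℤ) + (zeta X i ω n : ℤ) - (n : ℤ) + ((j : ℕ) : ℤ) + (t : ℤ)) ω =
          X ((i : ℤ) + (zeta X i ω n : ℤ) - (n : ℤ) + ((j : ℕ) : ℤ)) ω}

/-- The reconstructed past `X̃_{-n}(i)`. -/
noncomputable def tildeX (X : ℤ → Ω → 𝒳) (i : ℕ) (n : ℕ) (ω : Ω) : 𝒳 :=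
  X ((i : ℤ) + (zeta X i ω n : ℤ) - (n : ℤ)) ω

/-- The backward recurrence times `ζ̂ᵏ_i`. -/
noncomputable def hatZeta (X : ℤ → Ω → 𝒳) (k : ℕ) (ω : Ω) : ℕ → ℤ
  | 0 => 0
  | i + 1 =>
    hatZeta X k ω i -
      sInf {t : ℕ | 0 < t ∧ ∀ j : Fin (k - i),
        X (hatZeta X k ω i - ((k - i - 1 : ℕ) : ℤ) + ((j : ℕ) : ℤ) - (t : ℤ)) ω =
          X (hatZeta X k ω i - ((k - i - 1 : ℕ) : ℤ) + ((j : ℕ) : ℤ)) ω}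

/-- The transition matrix of the chain `Z` on the nonnegative integers. -/
noncomputable def Ptrans (s j : ℕ) : ℝ :=
  if s < j then (2 : ℝ) ^ (-((j : ℤ) - (s : ℤ)) - 1)
  else if j = s then (2 : ℝ) ^ (-(s : ℤ) - 1)
  else (2 : ℝ) ^ (-(j : ℤ) - 2)

/-- The backward memory-length estimator `χ_n`. -/
noncomputable def chiEst (γ β : ℝ) (X : ℤ → Ω → 𝒳) (n : ℕ) (ω : Ω) : ℕ :=
  if ∃ k, k < n ∧ NTEST γ β X n (pastWord X 0 k ω) ω then
    sInf {k : ℕ | k < n ∧ NTEST γ β X n (pastWord X 0 k ω) ω}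
  else n


noncomputable instance : MeasurableSpace ℤ_[2] := borel _

instance : BorelSpace ℤ_[2] := ⟨rfl⟩

/-- The normalised Haar measure on the dyadic integers. -/
noncomputable def dyadicHaar : Measure ℤ_[2] := Measure.addHaarMeasure ⊤

instance : IsProbabilityMeasure dyadicHaar :=
  ⟨by simpa [dyadicHaar] using
    Measure.addHaarMeasure_self (K₀ := (⊤ : TopologicalSpace.PositiveCompacts ℤ_[2]))⟩

instance : dyadicHaar.IsAddHaarMeasure := by unfold dyadicHaar; infer_instance

instance : dyadicHaar.Regular := by unfold dyadicHaar; infer_instance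

/-- The two-sided sequence coloring each point of the odometer orbit of `z` by its valuation. -/
noncomputable def path (c : ℕ → Bool) (z : ℤ_[2]) : ℤ → Bool := fun n => c (z + n).valuation

/-- The law of `path c` under Haar measure. -/
noncomputable def odoLaw (c : ℕ → Bool) : Measure (ℤ → Bool) := dyadicHaar.map (path c)

/-- Points whose odometer orbit avoids zero. -/
def AvoidsZero (z : ℤ_[2]) : Prop := ∀ j : ℤ, z + j ≠ 0

theorem pow_dvd_iff_le_valuation {x : ℤ_[2]} (hx : x ≠ 0) (n : ℕ) :
    (2 : ℤ_[2]) ^ n ∣ x ↔ n ≤ x.valuation := by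
  rw [← Ideal.mem_span_singleton]
  exact_mod_cast PadicInt.mem_span_pow_iff_le_valuation x hx n

theorem le_valuation_of_dvd_sub {x y : ℤ_[2]} (hx : x ≠ 0) (hy : y ≠ 0) {e : ℕ}
    (h : (2 : ℤ_[2]) ^ e ∣ x - y) (he : e ≤ x.valuation) : e ≤ y.valuation := by
  rw [← pow_dvd_iff_le_valuation hx] at he
  rw [← pow_dvd_iff_le_valuation hy]
  exact (dvd_sub_right he).1 h

theorem valuation_eq_of_dvd_sub {x y : ℤ_[2]} (hx : x ≠ 0) (hy : y ≠ 0)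
    (h : (2 : ℤ_[2]) ^ (x.valuation + 1) ∣ x - y) : y.valuation = x.valuation := by
  have h1 := le_valuation_of_dvd_sub hx hy ((pow_dvd_pow 2 (Nat.le_succ _)).trans h) le_rfl
  by_contra hne
  have h2 : x.valuation + 1 ≤ y.valuation := by omega
  have := le_valuation_of_dvd_sub hy hx ((dvd_sub_comm).1 h) h2
  omega

theorem color_eq_of_dvd_sub {c : ℕ → Bool} {m : ℕ} (hc : ∀ v ≥ m, c v = c m) {x y : ℤ_[2]}
    (hx : x ≠ 0) (hy : y ≠ 0) (h : (2 : ℤ_[2]) ^ m ∣ x - y) : c x.valuation = c y.valuation := by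
  by_cases hm : m ≤ x.valuation
  · rw [hc _ hm, hc _ (le_valuation_of_dvd_sub hx hy h hm)]
  · rw [valuation_eq_of_dvd_sub hx hy ((pow_dvd_pow 2 (by omega)).trans h)]

theorem valuation_eventually_eq {x : ℤ_[2]} (hx : x ≠ 0) :
    ∀ᶠ y in nhds x, y.valuation = x.valuation := by
  have h1 : ∀ᶠ y in nhds x, dist y x ≤ (2 : ℝ) ^ (-((x.valuation + 1 : ℕ) : ℤ)) :=
    Metric.closedBall_mem_nhds x (by positivity)
  have h2 : ∀ᶠ y in nhds x, y ≠ 0 := isOpen_ne.mem_nhds hx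
  filter_upwards [h1, h2] with y hy hy0
  refine valuation_eq_of_dvd_sub hx hy0 ?_
  rw [dist_comm, dist_eq_norm] at hy
  have := (PadicInt.norm_le_pow_iff_mem_span_pow (p := 2) (x - y) (x.valuation + 1)).1
    (by exact_mod_cast hy)
  rw [Ideal.mem_span_singleton] at this
  exact_mod_cast this

theorem measurable_valuation : Measurable (PadicInt.valuation : ℤ_[2] → ℕ) := by
  refine measurable_to_countable' fun n => ?_
  have h : IsOpen ((PadicInt.valuation : ℤ_[2] → ℕ) ⁻¹' {n} \ {0}) := by
    rw [isOpen_iff_mem_nhds]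
    rintro x ⟨hx, hx0⟩
    have h2 : ∀ᶠ y in nhds x, y ≠ 0 := isOpen_ne.mem_nhds hx0
    filter_upwards [valuation_eventually_eq hx0, h2] with y hy hy0
    exact ⟨hy.trans hx, hy0⟩
  by_cases h0 : (0 : ℤ_[2]) ∈ (PadicInt.valuation : ℤ_[2] → ℕ) ⁻¹' {n}
  · rw [← insert_sdiff_self_of_mem h0]
    exact h.measurableSet.insert 0
  · rw [← sdiff_singleton_eq_self h0]
    exact h.measurableSet

theorem measurable_path (c : ℕ → Bool) : Measurable (path c) := by
  refine measurable_pi_lambda _ fun n => ?_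
  exact (measurable_from_top (f := c)).comp (measurable_valuation.comp (measurable_add_const _))

instance (c : ℕ → Bool) : IsProbabilityMeasure (odoLaw c) :=
  Measure.isProbabilityMeasure_map (measurable_path c).aemeasurable

theorem path_add_intCast (c : ℕ → Bool) (z : ℤ_[2]) (l j : ℤ) :
    path c (z + l) j = path c z (l + j) := by
  simp [path, add_assoc]

theorem AvoidsZero.add_intCast {z : ℤ_[2]} (hz : AvoidsZero z) (l : ℤ) : AvoidsZero (z + l) :=
  fun j => by simpa [add_assoc] using hz (l + j)

theorem ergodic_odoLaw (c : ℕ → Bool) : Ergodic (shift Bool) (odoLaw c) := by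
  have hd : DenseRange (fun n : ℕ => n • (1 : ℤ_[2])) := by
    simpa using PadicInt.denseRange_natCast (p := 2)
  have he : Ergodic ((1 : ℤ_[2]) + ·) dyadicHaar := ergodic_add_left_of_denseRange_nsmul hd _
  have hcomm : path c ∘ ((1 : ℤ_[2]) + ·) = shift Bool ∘ path c := by
    funext z n
    have := path_add_intCast c z 1 n
    simp only [Function.comp, shift, add_comm (1 : ℤ_[2]) z]
    rw [add_comm n 1, ← this]
    simp
  have hmp : MeasurePreserving (path c) dyadicHaar (odoLaw c) := ⟨measurable_path c, rfl⟩
  have hs : Measurable (shift Bool) := measurable_pi_lambda _ fun n => measurable_pi_apply _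
  refine ⟨⟨hs, ?_⟩, (hmp.preErgodic_of_preErgodic_semiconj he.toPreErgodic fun z => congrFun hcomm z)⟩
  rw [odoLaw, Measure.map_map hs (measurable_path c), ← hcomm,
    ← Measure.map_map (measurable_path c) (measurable_const_add _), he.map_eq]

theorem neBot_nhdsNE_zero : (nhdsWithin (0 : ℤ_[2]) {0}ᶜ).NeBot := by
  rw [← mem_closure_iff_nhdsWithin_neBot, Metric.mem_closure_iff]
  intro ε hε
  obtain ⟨n, hn⟩ := exists_pow_lt_of_lt_one hε (by norm_num : (1 / 2 : ℝ) < 1)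
  refine ⟨(2 : ℤ_[2]) ^ n, by simp, ?_⟩
  have := PadicInt.norm_p_pow (p := 2) n
  rw [dist_zero_left]
  push_cast at this
  rw [this]
  simpa using hn

theorem dyadicHaar_singleton (x : ℤ_[2]) : dyadicHaar {x} = 0 := by
  have := neBot_nhdsNE_zero
  exact measure_singleton x

theorem ae_avoidsZero : ∀ᵐ z ∂dyadicHaar, AvoidsZero z := by
  refine ae_all_iff.2 fun j => ?_
  rw [ae_iff]
  have : {z : ℤ_[2] | ¬ (z + j ≠ 0)} = {(-j : ℤ_[2])} := by
    ext z; simp [eq_neg_iff_add_eq_zero]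
  rw [this]
  exact dyadicHaar_singleton _

section Words

variable {α β : Type*}

theorem pastWord_eq_map (X : ℤ → α → β) (l : ℤ) (k : ℕ) (ω : α) :
    pastWord X l k ω = (List.range k).map fun j : ℕ => X (l - (k : ℤ) + 1 + (j : ℤ)) ω := by
  simp [pastWord, ← List.map_eq_flatMap]

theorem length_pastWord (X : ℤ → α → β) (l : ℤ) (k : ℕ) (ω : α) :
    (pastWord X l k ω).length = k := by simp [pastWord_eq_map]

theorem wordEndsAt_iff_pastWord (X : ℤ → α → β) (l : ℤ) (w : List β) (ω : α) :
    wordEndsAt X l w ω ↔ pastWord X l w.length ω = w := by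
  constructor
  · intro h
    refine List.ext_getElem (length_pastWord ..) fun i h1 h2 => ?_
    simpa [pastWord_eq_map] using h ⟨i, h2⟩
  · intro h j
    have h2 : (j : ℕ) < (pastWord X l w.length ω).length := by rw [length_pastWord]; exact j.2
    have := List.getElem_of_eq h h2
    simpa [pastWord_eq_map] using this

theorem pastWord_add (X : ℤ → α → β) (l : ℤ) (b a : ℕ) (ω : α) :
    pastWord X l (b + a) ω = pastWord X (l - a) b ω ++ pastWord X l a ω := by
  simp only [pastWord_eq_map, List.range_add, List.map_append, List.map_map]
  congr 1
  · refine List.map_congr_left fun j _ => ?_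
    congr 1
    push_cast
    ring
  · refine List.map_congr_left fun j _ => ?_
    simp only [Function.comp]
    congr 1
    push_cast
    ring

theorem wordEndsAt_append (X : ℤ → α → β) (l : ℤ) (u v : List β) (ω : α) :
    wordEndsAt X l (u ++ v) ω ↔ wordEndsAt X (l - v.length) u ω ∧ wordEndsAt X l v ω := by
  simp only [wordEndsAt_iff_pastWord, List.length_append, pastWord_add]
  constructor
  · exact fun h => List.append_inj h (length_pastWord ..)
  · rintro ⟨h1, h2⟩
    rw [h1, h2]

theorem wordEndsAt_pastWord (X : ℤ → α → β) (l : ℤ) (k : ℕ) (ω ω' : α) :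
    wordEndsAt X l (pastWord X l k ω') ω ↔ ∀ j : ℤ, l - k < j → j ≤ l → X j ω = X j ω' := by
  constructor
  · intro h j h1 h2
    rw [wordEndsAt_iff_pastWord, length_pastWord] at h
    obtain ⟨i, hi⟩ := Int.eq_ofNat_of_zero_le (show 0 ≤ j - (l - k + 1) by omega)
    have hik : i < k := by omega
    have h3 := List.getElem_of_eq h (i := i) (by rwa [length_pastWord])
    have hj : l - k + 1 + (i : ℤ) = j := by omega
    simpa [pastWord_eq_map, hj] using h3
  · intro h
    rw [wordEndsAt_iff_pastWord, length_pastWord, pastWord_eq_map, pastWord_eq_map]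
    refine List.map_congr_left fun i hi => ?_
    rw [List.mem_range] at hi
    exact h _ (by omega) (by omega)

theorem wordEndsAt_singleton (X : ℤ → α → β) (l : ℤ) (y : β) (ω : α) :
    wordEndsAt X l [y] ω ↔ X l ω = y := by
  simp [wordEndsAt_iff_pastWord, pastWord_eq_map]

theorem wordEndsAt_concat (X : ℤ → α → β) (l : ℤ) (w : List β) (y : β) (ω : α) :
    wordEndsAt X (l + 1) (w ++ [y]) ω ↔ wordEndsAt X l w ω ∧ X (l + 1) ω = y := by
  rw [wordEndsAt_append, wordEndsAt_singleton]
  simp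

theorem wordProb_pos_iff [MeasurableSpace α] {μ : Measure α} [IsFiniteMeasure μ] (X : ℤ → α → β) (w : List β) :
    0 < wordProb μ X w ↔ 0 < μ (cyl X 0 w) := by
  rw [wordProb, ENNReal.toReal_pos_iff]
  simp

end Words

theorem pastWord_path_add (c : ℕ → Bool) (z : ℤ_[2]) (l m : ℤ) (k : ℕ) :
    pastWord (proc Bool) l k (path c (z + m)) = pastWord (proc Bool) (l + m) k (path c z) := by
  simp only [pastWord_eq_map]
  refine List.map_congr_left fun j _ => ?_
  simp only [proc, path_add_intCast]
  congr 1
  ring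

theorem wordEndsAt_path_add (c : ℕ → Bool) (z : ℤ_[2]) (l m : ℤ) (w : List Bool) :
    wordEndsAt (proc Bool) l w (path c (z + m)) ↔
      wordEndsAt (proc Bool) (l + m) w (path c z) := by
  rw [wordEndsAt_iff_pastWord, wordEndsAt_iff_pastWord, pastWord_path_add]

theorem measurable_proc (l : ℤ) : Measurable (proc Bool l) := measurable_pi_apply l

theorem measurableSet_cyl (l : ℤ) (w : List Bool) : MeasurableSet (cyl (proc Bool) l w) := by
  have : cyl (proc Bool) l w = ⋂ j : Fin w.length,
      proc Bool (l - (w.length : ℤ) + 1 + ((j : ℕ) : ℤ)) ⁻¹' {w.get j} := by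
    ext ω; simp [cyl, wordEndsAt]
  rw [this]
  exact MeasurableSet.iInter fun j => measurable_proc _ (measurableSet_singleton _)

theorem measurableSet_proc_eq (l : ℤ) (y : Bool) : MeasurableSet {ω | proc Bool l ω = y} :=
  measurable_proc l (measurableSet_singleton y)

theorem odoLaw_pos (c : ℕ → Bool) {S : Set (ℤ → Bool)} (hS : MeasurableSet S) {z : ℤ_[2]}
    {a b : ℤ} (hz : ∀ j ∈ Icc a b, z + j ≠ 0)
    (h : ∀ ω : ℤ → Bool, (∀ j ∈ Icc a b, ω j = path c z j) → ω ∈ S) : 0 < odoLaw c S := by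
  rw [odoLaw, Measure.map_apply (measurable_path c) hS]
  refine Measure.measure_pos_of_mem_nhds (x := z) _ ?_
  have hj : ∀ j ∈ Icc a b, ∀ᶠ y in nhds z, (y + (j : ℤ_[2])).valuation = (z + j).valuation :=
    fun j hj => (continuous_add_const (j : ℤ_[2])).continuousAt.eventually
      (valuation_eventually_eq (hz j hj))
  filter_upwards [(eventually_all_finite (finite_Icc a b)).2 hj] with y hy
  exact h _ fun j hj => congrArg c (hy j hj)

theorem exists_avoidsZero_of_odoLaw_pos (c : ℕ → Bool) {S : Set (ℤ → Bool)}
    (hS : MeasurableSet S) (h : 0 < odoLaw c S) : ∃ z, AvoidsZero z ∧ path c z ∈ S := by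
  rw [odoLaw, Measure.map_apply (measurable_path c) hS] at h
  by_contra! hne
  refine h.ne' (measure_mono_null (fun z hz hz' => hne z hz' hz) ?_)
  exact ae_iff.1 ae_avoidsZero

theorem exists_path_of_wordProb_pos (c : ℕ → Bool) {w : List Bool}
    (h : 0 < wordProb (odoLaw c) (proc Bool) w) (l : ℤ) :
    ∃ z, AvoidsZero z ∧ wordEndsAt (proc Bool) l w (path c z) := by
  rw [wordProb_pos_iff] at h
  obtain ⟨z, hz, hw⟩ := exists_avoidsZero_of_odoLaw_pos c (measurableSet_cyl 0 w) h
  refine ⟨z + (-l : ℤ), hz.add_intCast _, ?_⟩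
  rw [wordEndsAt_path_add]
  simpa [cyl] using hw

theorem wordProb_pos_of_path (c : ℕ → Bool) {w : List Bool} {z : ℤ_[2]} {l : ℤ}
    (hz : ∀ j ∈ Ioc (l - w.length) l, z + j ≠ 0)
    (hw : wordEndsAt (proc Bool) l w (path c z)) :
    0 < wordProb (odoLaw c) (proc Bool) w := by
  rw [wordProb_pos_iff]
  refine odoLaw_pos c (measurableSet_cyl 0 w) (z := z + l) (a := -w.length + 1) (b := 0) ?_ ?_
  · rintro j ⟨h1, h2⟩
    simpa [add_assoc] using hz (l + j) ⟨by omega, by omega⟩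
  · intro ω hω
    have hw' : wordEndsAt (proc Bool) 0 w (path c (z + l)) := by
      rw [wordEndsAt_path_add]; simpa using hw
    rw [wordEndsAt_iff_pastWord] at hw'
    change wordEndsAt _ _ _ _
    rw [← hw', wordEndsAt_pastWord]
    exact fun j h1 h2 => hω j ⟨by omega, h2⟩

/-- The next symbol after an occurrence of `w` at time `0` is `y`, off the orbit of zero. -/
def ForcesNext (c : ℕ → Bool) (w : List Bool) (y : Bool) : Prop :=
  ∀ z, AvoidsZero z → wordEndsAt (proc Bool) 0 w (path c z) → path c z 1 = y

theorem ForcesNext.append_left {c : ℕ → Bool} {w : List Bool} {y : Bool}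
    (h : ForcesNext c w y) (u : List Bool) : ForcesNext c (u ++ w) y :=
  fun z hz hw => h z hz ((wordEndsAt_append ..).1 hw).2

theorem ForcesNext.condProb_eq_one {c : ℕ → Bool} {w : List Bool} {y : Bool}
    (h : ForcesNext c w y) (hw : 0 < wordProb (odoLaw c) (proc Bool) w) :
    condProb (odoLaw c) (proc Bool) y w = 1 := by
  rw [condProb, div_eq_one_iff_eq hw.ne', wordProb]
  congr 1
  refine (measure_inter_add_sdiff (cyl (proc Bool) 0 w) (measurableSet_proc_eq 1 y)).symm.trans ?_
    |>.symm
  suffices odoLaw c (cyl (proc Bool) 0 w \ {ω | proc Bool 1 ω = y}) = 0 by rw [this, add_zero]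
  by_contra hne
  obtain ⟨z, hz, h1, h2⟩ := exists_avoidsZero_of_odoLaw_pos c
    ((measurableSet_cyl 0 w).diff (measurableSet_proc_eq 1 y)) (pos_iff_ne_zero.2 hne)
  exact h2 (h z hz h1)

theorem ForcesNext.isMemoryWord {c : ℕ → Bool} {w : List Bool} {y : Bool}
    (h : ForcesNext c w y) (hw : 0 < wordProb (odoLaw c) (proc Bool) w) :
    IsMemoryWord (odoLaw c) (proc Bool) w := by
  refine ⟨hw, fun u x _ hpos => ?_⟩
  obtain ⟨z, hz, hzw⟩ := exists_path_of_wordProb_pos c hpos (0 + 1)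
  rw [wordEndsAt_concat] at hzw
  obtain rfl : y = x := (h.append_left u z hz hzw.1).symm.trans hzw.2
  have hu : 0 < wordProb (odoLaw c) (proc Bool) (u ++ w) :=
    wordProb_pos_of_path c (fun j _ => hz j) hzw.1
  rw [h.condProb_eq_one hw, (h.append_left u).condProb_eq_one hu]

theorem not_isMemoryWord {c : ℕ → Bool} {u w : List Bool} {y : Bool} {z z' : ℤ_[2]}
    (hu : u ≠ []) (hf : ForcesNext c (u ++ w) y) (hz : AvoidsZero z)
    (hzw : wordEndsAt (proc Bool) 0 (u ++ w) (path c z))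
    (hz' : ∀ j ∈ Ioc (-w.length : ℤ) 1, z' + j ≠ 0)
    (hzw' : wordEndsAt (proc Bool) 0 w (path c z')) (hy : path c z' 1 ≠ y) :
    ¬ IsMemoryWord (odoLaw c) (proc Bool) w := by
  rintro ⟨hw, hmem⟩
  have huw : 0 < wordProb (odoLaw c) (proc Bool) (u ++ w) :=
    wordProb_pos_of_path c (fun j _ => hz j) hzw
  have hcond := hmem u y hu <| wordProb_pos_of_path c (l := 0 + 1) (z := z) (fun j _ => hz j)
    ((wordEndsAt_concat ..).2 ⟨hzw, hf z hz hzw⟩)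
  rw [hf.condProb_eq_one huw, condProb, div_eq_one_iff_eq hw.ne', wordProb] at hcond
  have hsplit := measure_inter_add_sdiff (μ := odoLaw c) (cyl (proc Bool) 0 w)
    (measurableSet_proc_eq 1 y)
  have hpos : 0 < odoLaw c (cyl (proc Bool) 0 w \ {ω | proc Bool 1 ω = y}) := by
    refine odoLaw_pos c ((measurableSet_cyl 0 w).diff (measurableSet_proc_eq 1 y)) (z := z')
      (a := -w.length + 1) (b := 1) (fun j hj => hz' j ⟨by have := hj.1; omega, hj.2⟩) ?_
    intro ω hω
    constructor
    · rw [wordEndsAt_iff_pastWord] at hzw'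
      change wordEndsAt _ _ _ _
      rw [← hzw', wordEndsAt_pastWord]
      exact fun j h1 h2 => hω j ⟨by omega, by omega⟩
    · intro h1
      exact hy ((hω 1 ⟨by omega, le_rfl⟩).symm.trans h1)
  rw [ENNReal.toReal_eq_toReal_iff' (measure_ne_top _ _) (measure_ne_top _ _)] at hcond
  rw [hcond] at hsplit
  exact hpos.ne' ((ENNReal.add_right_inj (measure_ne_top _ _)).1 (hsplit.trans (add_zero _).symm))

theorem exists_valuation_add_eq {z : ℤ_[2]} (hz : AvoidsZero z) (v : ℕ) :
    ∃ j : ℤ, -(2 : ℤ) ^ (v + 1) < j ∧ j ≤ 0 ∧ (z + j).valuation = v := by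
  have ha : (2 : ℤ_[2]) ^ (v + 1) ∣ z - (z.appr (v + 1) : ℕ) := by
    have := PadicInt.appr_spec (p := 2) (v + 1) z
    rw [Ideal.mem_span_singleton] at this
    exact_mod_cast this
  have hpos : (0 : ℤ) < 2 ^ (v + 1) := by positivity
  set t : ℤ := (z.appr (v + 1) : ℤ) - 2 ^ v with ht
  refine ⟨-(t % 2 ^ (v + 1)), by have := Int.emod_lt_of_pos t hpos; omega,
    by have := Int.emod_nonneg t hpos.ne'; omega, ?_⟩
  have hval : ((2 : ℤ_[2]) ^ v).valuation = v := by
    have := PadicInt.valuation_pow (p := 2) (2 : ℤ_[2]) v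
    have h2 := PadicInt.valuation_p (p := 2)
    push_cast at h2
    rw [this, h2, mul_one]
  have h3 : ((2 : ℤ_[2]) ^ (v + 1)) ∣ ((t - t % 2 ^ (v + 1) : ℤ) : ℤ_[2]) := by
    have : (2 : ℤ) ^ (v + 1) ∣ t - t % 2 ^ (v + 1) := Int.dvd_self_sub_emod
    have := (Int.castRingHom ℤ_[2]).map_dvd this
    simpa using this
  refine (valuation_eq_of_dvd_sub (x := (2 : ℤ_[2]) ^ v) (by simp) (hz _) ?_).trans hval
  rw [hval, dvd_sub_comm]
  convert dvd_add ha h3 using 1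
  rw [ht]
  push_cast
  ring

/-- A window length that determines the next symbol, for points of small next valuation, or for
all points if the coloring is eventually constant. -/
theorem exists_determining_window (c : ℕ → Bool) (E : ℕ) :
    ∃ k : ℕ, ∀ z z' : ℤ_[2], AvoidsZero z → AvoidsZero z' →
      ((z + 1).valuation ≤ E ∨ ∀ v ≥ E, c v = c E) →
      (∀ j : ℤ, -(k : ℤ) < j → j ≤ 0 → path c z' j = path c z j) → path c z' 1 = path c z 1 := by
  have hV : ∀ e, ∃ V, (∃ v, e < v ∧ c v ≠ c e) → e < V ∧ c V ≠ c e := by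
    intro e
    by_cases h : ∃ v, e < v ∧ c v ≠ c e
    · exact ⟨h.choose, fun _ => h.choose_spec⟩
    · exact ⟨0, fun h' => absurd h' h⟩
  choose V hV using hV
  refine ⟨2 ^ ((Finset.range (E + 1)).sup V + 1), fun z z' hz hz' hE hpast => ?_⟩
  have hz1 : z + 1 ≠ 0 := by simpa using hz 1
  have hz1' : z' + 1 ≠ 0 := by simpa using hz' 1
  simp only [path, Int.cast_one]
  by_cases hd : z' - z = 0
  · rw [sub_eq_zero.1 hd]
  have hdvd : (2 : ℤ_[2]) ^ (z' - z).valuation ∣ (z + 1) - (z' + 1) := by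
    rw [add_sub_add_right_eq_sub, dvd_sub_comm]
    exact (pow_dvd_iff_le_valuation hd _).2 le_rfl
  rcases lt_or_ge E (z' - z).valuation with he | he
  · rcases hE with hE | hE
    · rw [valuation_eq_of_dvd_sub hz1 hz1' ((pow_dvd_pow 2 (by omega)).trans hdvd)]
    · exact (color_eq_of_dvd_sub hE hz1 hz1' ((pow_dvd_pow 2 he.le).trans hdvd)).symm
  by_cases hex : ∃ v, (z' - z).valuation < v ∧ c v ≠ c (z' - z).valuation
  · exfalso
    obtain ⟨hlt, hne⟩ := hV _ hex
    obtain ⟨j, hj1, hj2, hj⟩ := exists_valuation_add_eq hz (V (z' - z).valuation)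
    have hle : V (z' - z).valuation ≤ (Finset.range (E + 1)).sup V :=
      Finset.le_sup (Finset.mem_range.2 (by omega))
    have hpow : (2 : ℤ) ^ (V (z' - z).valuation + 1) ≤ 2 ^ ((Finset.range (E + 1)).sup V + 1) :=
      pow_le_pow_right₀ (by norm_num) (by omega)
    have hcol := hpast j (by push_cast; omega) hj2
    have hval : (z' + j).valuation = (z' - z).valuation := by
      refine valuation_eq_of_dvd_sub hd (hz' j) ?_
      have : z' - z - (z' + j) = -(z + j) := by ring
      rw [this, dvd_neg, pow_dvd_iff_le_valuation (hz j), hj]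
      exact hlt
    simp only [path, hval, hj] at hcol
    exact hne hcol.symm
  · push Not at hex
    refine (color_eq_of_dvd_sub (m := (z' - z).valuation) (fun v hv => ?_) hz1 hz1' hdvd).symm
    rcases hv.eq_or_lt with rfl | hv
    · rfl
    · exact hex v hv

theorem exists_forcesNext (c : ℕ → Bool) {z : ℤ_[2]} (hz : AvoidsZero z) :
    ∃ k₀ : ℕ, ∀ k ≥ k₀, ForcesNext c (pastWord (proc Bool) 0 k (path c z)) (path c z 1) := by
  obtain ⟨k₀, hk₀⟩ := exists_determining_window c (z + 1).valuation
  refine ⟨k₀, fun k hk z' hz' hw => hk₀ z z' hz hz' (Or.inl le_rfl) fun j h1 h2 => ?_⟩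
  exact (wordEndsAt_pastWord ..).1 hw j (by omega) h2

theorem exists_isMemoryWord (c : ℕ → Bool) {z : ℤ_[2]} (hz : AvoidsZero z) (l : ℤ) :
    ∃ k, IsMemoryWord (odoLaw c) (proc Bool) (pastWord (proc Bool) l k (path c z)) := by
  obtain ⟨k, hk⟩ := exists_forcesNext c (hz.add_intCast l)
  specialize hk k le_rfl
  have hpos : 0 < wordProb (odoLaw c) (proc Bool)
      (pastWord (proc Bool) 0 k (path c (z + l))) :=
    wordProb_pos_of_path c (fun j _ => hz.add_intCast l j)
      ((wordEndsAt_pastWord ..).2 fun _ _ _ => rfl)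
  have := hk.isMemoryWord hpos
  rw [pastWord_path_add, zero_add] at this
  exact ⟨k, this⟩

theorem markovOfOrder_odoLaw {c : ℕ → Bool} {m : ℕ} (hc : ∀ v ≥ m, c v = c m) :
    ∃ L, MarkovOfOrder (odoLaw c) L := by
  obtain ⟨k, hk⟩ := exists_determining_window c m
  refine ⟨k, fun w hwk hw => ?_⟩
  obtain ⟨z, hz, hzw⟩ := exists_path_of_wordProb_pos c hw 0
  refine ForcesNext.isMemoryWord (y := path c z 1) (fun z' hz' hzw' => ?_) hw
  refine hk z z' hz hz' (Or.inr hc) fun j h1 h2 => ?_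
  rw [wordEndsAt_iff_pastWord] at hzw
  rw [← hzw, wordEndsAt_pastWord] at hzw'
  exact hzw' j (by omega) h2

theorem finitarilyMarkovian_odoLaw (c : ℕ → Bool) :
    FinitarilyMarkovian (odoLaw c) (proc Bool) := by
  have hset : {ω | ∃ k, IsMemoryWord (odoLaw c) (proc Bool) (pastWord (proc Bool) 0 k ω)} =
      ⋃ w : {w : List Bool // IsMemoryWord (odoLaw c) (proc Bool) w}, cyl (proc Bool) 0 w := by
    ext ω
    simp only [mem_ofPred_eq, mem_iUnion, cyl, wordEndsAt_iff_pastWord]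
    constructor
    · rintro ⟨k, hk⟩
      exact ⟨⟨_, hk⟩, by rw [length_pastWord]⟩
    · rintro ⟨w, hw⟩
      exact ⟨_, hw ▸ w.2⟩
  have hmeas : MeasurableSet
      {ω | ∃ k, IsMemoryWord (odoLaw c) (proc Bool) (pastWord (proc Bool) 0 k ω)} := by
    rw [hset]
    exact MeasurableSet.iUnion fun w => measurableSet_cyl 0 _
  rw [FinitarilyMarkovian]
  refine (ae_map_iff (measurable_path c).aemeasurable hmeas).2 ?_
  filter_upwards [ae_avoidsZero] with z hz
  exact exists_isMemoryWord c hz 0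

theorem not_isMemoryWord_pastWord_of_flip {c c' : ℕ → Bool} {m m' B : ℕ}
    (hconst : ∀ v ≥ m, c' v = c' m) (hagree : ∀ v < m', c v = c' v) (hflip : c m' ≠ c' m)
    (hB : B < 2 ^ m') {x : ℤ_[2]} (hx : AvoidsZero x)
    (hwin : ∀ j : ℤ, -(B : ℤ) ≤ j → j ≤ 1 → (x + j).valuation < m') (hmm : m ≤ m')
    (hdvd : (2 : ℤ_[2]) ^ m ∣ x + 1) {a : ℕ} (ha : a ≤ B) :
    ¬ IsMemoryWord (odoLaw c) (proc Bool) (pastWord (proc Bool) 0 a (path c x)) := by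
  have hx1 : x + 1 ≠ 0 := by simpa using hx 1
  have hBz : (B : ℤ) < 2 ^ m' := by exact_mod_cast hB
  have hnext : path c x 1 = c' m := by
    have h1 := hwin 1 (by omega) le_rfl
    rw [Int.cast_one] at h1
    simp only [path, Int.cast_one]
    rw [hagree _ h1, hconst _ ((pow_dvd_iff_le_valuation hx1 m).1 hdvd)]
  obtain ⟨k, hk⟩ := exists_forcesNext c hx
  have hcast : ∀ j : ℤ, ((2 : ℤ_[2]) ^ m' - 1) + j = ((2 ^ m' - 1 + j : ℤ) : ℤ_[2]) := by
    intro j; push_cast; ring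
  have hne : ∀ j ∈ Ioc (-a : ℤ) 1, ((2 : ℤ_[2]) ^ m' - 1) + j ≠ 0 := by
    rintro j ⟨hj1, hj2⟩
    rw [hcast, Int.cast_ne_zero]
    omega
  have hsplit := pastWord_add (proc Bool) 0 (k + 1) a (path c x)
  have hf := hk (k + 1 + a) (by omega)
  rw [hsplit] at hf
  refine not_isMemoryWord (z := x) (z' := (2 : ℤ_[2]) ^ m' - 1) ?_ hf hx ?_ ?_ ?_ ?_
  · rw [Ne, ← List.length_eq_zero_iff, length_pastWord]
    omega
  · rw [← hsplit]
    exact (wordEndsAt_pastWord ..).2 fun _ _ _ => rfl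
  · rwa [length_pastWord]
  · refine (wordEndsAt_pastWord ..).2 fun j hj1 hj2 => ?_
    have hj : ((2 : ℤ_[2]) ^ m' - 1) + j ≠ 0 := hne j ⟨by omega, by omega⟩
    have hlt : ((2 : ℤ_[2]) ^ m' - 1 + j).valuation < m' := by
      by_contra! hge
      rw [← pow_dvd_iff_le_valuation hj, hcast] at hge
      have h2 := (PadicInt.pow_p_dvd_int_iff (p := 2) m' (2 ^ m' - 1 + j)).1
        (by exact_mod_cast hge)
      have h3 := Int.le_of_dvd (by omega) h2
      push_cast at h3
      omega
    simp only [proc, path]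
    rw [hagree _ hlt, hagree _ (hwin j (by omega) (by omega))]
    refine color_eq_of_dvd_sub hconst hj (hx j) ?_
    have : (2 : ℤ_[2]) ^ m' - 1 + j - (x + j) = 2 ^ m' - (x + 1) := by ring
    rw [this]
    exact dvd_sub (pow_dvd_pow 2 hmm) hdvd
  · have hval : ((2 : ℤ_[2]) ^ m').valuation = m' := by
      have := PadicInt.valuation_pow (p := 2) (2 : ℤ_[2]) m'
      have h2 := PadicInt.valuation_p (p := 2)
      push_cast at h2
      rw [this, h2, mul_one]
    rw [hnext]
    simpa [path, hval] using hflip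

theorem lt_memoryLenNat_of_flip {c c' : ℕ → Bool} {m m' B : ℕ}
    (hconst : ∀ v ≥ m, c' v = c' m) (hagree : ∀ v < m', c v = c' v) (hflip : c m' ≠ c' m)
    (hB : B < 2 ^ m') {z : ℤ_[2]} (hz : AvoidsZero z) {l : ℤ}
    (hwin : ∀ j : ℤ, l - B ≤ j → j ≤ l + 1 → (z + j).valuation < m') (hmm : m ≤ m')
    (hdvd : (2 : ℤ_[2]) ^ m ∣ z + l + 1) :
    B < memoryLenNat (odoLaw c) (proc Bool) l (path c z) := by
  by_contra! hle
  have hmem := Nat.sInf_mem (s := {k : ℕ | IsMemoryWord (odoLaw c) (proc Bool)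
    (pastWord (proc Bool) l k (path c z))}) (exists_isMemoryWord c hz l)
  have hnot := not_isMemoryWord_pastWord_of_flip hconst hagree hflip hB (hz.add_intCast l)
    (fun j h1 h2 => by simpa [add_assoc] using hwin (l + j) (by omega) (by omega)) hmm hdvd hle
  rw [pastWord_path_add, zero_add] at hnot
  exact hnot hmem

theorem exists_dvd_add_of_tendsto_div {f : ℕ → ℕ} (hf : StrictMono f)
    (hlim : Tendsto (fun n : ℕ => (f n : ℝ) / n) atTop (nhds 1)) {q : ℕ} (hq : 0 < q)
    (r k : ℕ) : ∃ n ≥ k, q ∣ f n + r := by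
  by_contra! hno
  have hstep : ∀ n ≥ k, f n + q + 1 ≤ f (n + q) := by
    intro n hn
    by_contra! hlt
    obtain ⟨i, hi, hdvd⟩ : ∃ i ≤ q, q ∣ f n + i + r := by
      refine ⟨q - (f n + r) % q, Nat.sub_le _ _, ?_⟩
      have h1 := Nat.mod_lt (f n + r) hq
      have h2 := Nat.div_add_mod (f n + r) q
      refine ⟨(f n + r) / q + 1, ?_⟩
      rw [mul_add]
      omega
    have h1 := hf.add_le_nat i n
    have h2 := hf.add_le_nat (q - i) (n + i)
    rw [show q - i + (n + i) = n + q by omega] at h2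
    rw [add_comm i n] at h1
    have h4 : f (n + i) = f n + i := by omega
    exact hno (n + i) (by omega) (h4 ▸ hdvd)
  have hgrow : ∀ t, t * (q + 1) ≤ f (k + t * q) := by
    intro t
    induction t with
    | zero => simp
    | succ t ih =>
      have := hstep (k + t * q) (by omega)
      rw [show k + t * q + q = k + (t + 1) * q by ring] at this
      nlinarith
  have hq' : (1 : ℝ) ≤ q := by exact_mod_cast hq
  have hev : ∀ᶠ n : ℕ in atTop, (f n : ℝ) / n < 1 + 1 / (2 * q) :=
    hlim.eventually (gt_mem_nhds (by simp; positivity))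
  obtain ⟨N, hN⟩ := eventually_atTop.1 hev
  set t := N + 4 * k + 1 with ht
  have htq : t ≤ t * q := Nat.le_mul_of_pos_right _ hq
  have h1 := hN (k + t * q) (by omega)
  have hpos : (0 : ℝ) < ((k + t * q : ℕ) : ℝ) := by
    have : 0 < k + t * q := by omega
    exact_mod_cast this
  rw [div_lt_iff₀ hpos] at h1
  have h2 : ((t * (q + 1) : ℕ) : ℝ) ≤ f (k + t * q) := by exact_mod_cast hgrow t
  push_cast at h1 h2
  have h3 : (1 + 1 / (2 * (q : ℝ))) * (k + t * q) = k + t * q + k / (2 * q) + t / 2 := by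
    field_simp
    ring
  have h4 : (k : ℝ) / (2 * q) ≤ k := by
    apply div_le_self (by positivity); linarith
  have h5 : (4 * k + 1 : ℝ) ≤ t := by rw [ht]; push_cast; linarith [Nat.cast_nonneg (α := ℝ) N]
  nlinarith

theorem exists_uniform_bound (lam h : ℕ → (ℕ → Bool) → ℕ)
    (hmono : ∀ (n : ℕ) (x : ℕ → Bool), lam n x < lam (n + 1) x)
    {c : ℕ → Bool} {m : ℕ} (hc : ∀ v ≥ m, c v = c m)
    (hlim : ∀ᵐ ω ∂odoLaw c, Tendsto
      (fun n : ℕ => (lam n (fun i : ℕ => ω (i : ℤ)) : ℝ) / n) atTop (nhds 1)) (k : ℕ) :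
    ∃ B : ℕ, ∀ z, AvoidsZero z → ∃ n ≥ k, lam n (fun i : ℕ => path c z i) ≤ B ∧
      h n (fun i : ℕ => path c z i) ≤ B ∧
      (2 : ℤ_[2]) ^ m ∣ z + (lam n (fun i : ℕ => path c z i) : ℕ) + 1 := by
  have hres : ∀ r : ℕ, ∃ B : ℕ, ∀ z, AvoidsZero z → (2 : ℤ_[2]) ^ m ∣ z - r → ∃ n ≥ k,
      lam n (fun i : ℕ => path c z i) ≤ B ∧ h n (fun i : ℕ => path c z i) ≤ B ∧
      (2 : ℤ_[2]) ^ m ∣ z + (lam n (fun i : ℕ => path c z i) : ℕ) + 1 := by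
    intro r
    have hball : {z : ℤ_[2] | (2 : ℤ_[2]) ^ m ∣ z - r} ∈ nhds (r : ℤ_[2]) := by
      refine mem_of_superset (Metric.closedBall_mem_nhds (r : ℤ_[2])
        (ε := (2 : ℝ) ^ (-(m : ℤ))) (by positivity)) fun z hz => ?_
      rw [Metric.mem_closedBall, dist_eq_norm] at hz
      have := (PadicInt.norm_le_pow_iff_mem_span_pow (p := 2) (z - r) m).1 (by exact_mod_cast hz)
      rw [Ideal.mem_span_singleton] at this
      exact_mod_cast this
    have hpos := Measure.measure_pos_of_mem_nhds dyadicHaar hball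
    have hlim' := ae_of_ae_map (measurable_path c).aemeasurable hlim
    obtain ⟨z₀, hz₀r, hz₀, hz₀lim⟩ : ∃ z₀, (2 : ℤ_[2]) ^ m ∣ z₀ - r ∧ AvoidsZero z₀ ∧ Tendsto
        (fun n : ℕ => (lam n (fun i : ℕ => path c z₀ i) : ℝ) / n) atTop (nhds 1) := by
      by_contra! hnone
      refine hpos.ne' (measure_mono_null (fun z hz => ?_) (ae_iff.1 (ae_avoidsZero.and hlim')))
      exact fun hboth => hnone z hz hboth.1 hboth.2
    have happr := PadicInt.appr_spec (p := 2) m (z₀ + 1)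
    rw [Ideal.mem_span_singleton] at happr
    push_cast at happr
    obtain ⟨n, hn, hdvd⟩ := exists_dvd_add_of_tendsto_div
      (strictMono_nat_of_lt_succ fun n => hmono n _) hz₀lim (q := 2 ^ m) (by positivity)
      ((z₀ + 1).appr m) k
    have hdvd₀ : (2 : ℤ_[2]) ^ m ∣ z₀ + (lam n (fun i : ℕ => path c z₀ i) : ℕ) + 1 := by
      have := Nat.cast_dvd_cast (α := ℤ_[2]) hdvd
      push_cast at this
      convert dvd_add happr this using 1
      ring
    refine ⟨max (lam n fun i : ℕ => path c z₀ i) (h n fun i : ℕ => path c z₀ i),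
      fun z hz hzr => ⟨n, hn, ?_⟩⟩
    have hzz : (2 : ℤ_[2]) ^ m ∣ z - z₀ := by simpa using dvd_sub hzr hz₀r
    have hpath : path c z = path c z₀ := by
      funext j
      exact color_eq_of_dvd_sub hc (hz j) (hz₀ j) (by simpa using hzz)
    rw [hpath]
    refine ⟨le_max_left _ _, le_max_right _ _, ?_⟩
    convert dvd_add hzz hdvd₀ using 1
    ring
  choose b hb using hres
  refine ⟨(Finset.range (2 ^ m)).sup b, fun z hz => ?_⟩
  have happr := PadicInt.appr_spec (p := 2) m z
  rw [Ideal.mem_span_singleton] at happr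
  obtain ⟨n, hn, h1, h2, h3⟩ := hb (z.appr m) z hz (by exact_mod_cast happr)
  have hle : b (z.appr m) ≤ (Finset.range (2 ^ m)).sup b :=
    Finset.le_sup (Finset.mem_range.2 (PadicInt.appr_lt z m))
  exact ⟨n, hn, h1.trans hle, h2.trans hle, h3⟩

theorem exists_measure_valuation_ge_le (m B : ℕ) {ε : ℝ≥0∞} (hε : 0 < ε) :
    ∃ m' > m, B < 2 ^ m' ∧
      dyadicHaar (⋃ j ∈ Icc (-B : ℤ) (B + 1), {z | m' ≤ (z + j).valuation}) ≤ ε := by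
  set D : ℕ → Set ℤ_[2] := fun n => ⋃ j ∈ Icc (-B : ℤ) (B + 1), {z | n ≤ (z + j).valuation}
  have hmeas : ∀ n, MeasurableSet (D n) := fun n =>
    MeasurableSet.biUnion (to_countable _) fun j _ =>
      (measurable_valuation.comp (measurable_add_const (j : ℤ_[2]))) measurableSet_Ici
  have hanti : Antitone D := fun a b hab =>
    iUnion₂_mono fun j _ z (hz : b ≤ (z + j).valuation) => hab.trans hz
  have hempty : ⋂ n, D n = ∅ := by
    refine eq_empty_of_forall_notMem fun z hz => ?_
    have hb : BddAbove ((fun j : ℤ => (z + j).valuation) '' Icc (-B : ℤ) (B + 1)) :=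
      ((finite_Icc _ _).image _).bddAbove
    obtain ⟨M, hM⟩ := hb
    obtain ⟨j, hj, hle⟩ := mem_iUnion₂.1 (mem_iInter.1 hz (M + 1))
    exact absurd (hM ⟨j, hj, rfl⟩) (not_le.2 hle)
  have htend := tendsto_measure_iInter_atTop (μ := dyadicHaar)
    (fun n => (hmeas n).nullMeasurableSet) hanti ⟨0, measure_ne_top _ _⟩
  rw [hempty, measure_empty] at htend
  obtain ⟨m', h1, h2, h3⟩ := ((eventually_gt_atTop m).and
    ((eventually_ge_atTop B).and (htend.eventually (gt_mem_nhds hε)))).exists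
  exact ⟨m', h1, h2.trans_lt Nat.lt_two_pow_self, h3.le⟩

theorem exists_coloring (R : ℕ → (ℕ → Bool) → ℕ → ℕ → Prop)
    (hR : ∀ k c m, (∀ v ≥ m, c v = c m) → ∃ m' > m, R k c m m') :
    ∃ c : ℕ → Bool, ∀ k, ∃ c' m m', m < m' ∧ (∀ v ≥ m, c' v = c' m) ∧ R k c' m m' ∧
      (∀ v < m', c v = c' v) ∧ c m' ≠ c' m := by
  have hR' : ∀ k c m, ∃ m', (∀ v ≥ m, c v = c m) → m < m' ∧ R k c m m' := by
    intro k c m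
    by_cases h : ∀ v ≥ m, c v = c m
    · obtain ⟨m', h1, h2⟩ := hR k c m h
      exact ⟨m', fun _ => ⟨h1, h2⟩⟩
    · exact ⟨0, fun h' => absurd h' h⟩
  choose f hf using hR'
  let s : ℕ → (ℕ → Bool) × ℕ := fun k => Nat.rec (fun _ => false, 0)
    (fun k p => (fun v => if v < f k p.1 p.2 then p.1 v else !p.1 p.2, f k p.1 p.2)) k
  have hs₁ : ∀ k v, (s (k + 1)).1 v = if v < (s (k + 1)).2 then (s k).1 v else !(s k).1 (s k).2 :=
    fun _ _ => rfl
  have hconst : ∀ k, ∀ v ≥ (s k).2, (s k).1 v = (s k).1 (s k).2 := by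
    intro k v hv
    cases k with
    | zero => rfl
    | succ k => rw [hs₁, hs₁, if_neg (not_lt.2 hv), if_neg (lt_irrefl _)]
  have hstep : ∀ k, (s k).2 < (s (k + 1)).2 ∧ R k (s k).1 (s k).2 (s (k + 1)).2 :=
    fun k => hf k _ _ (hconst k)
  have hmono : StrictMono fun k => (s k).2 := strictMono_nat_of_lt_succ fun k => (hstep k).1
  have hstable : ∀ k i v, k ≤ i → v < (s (k + 1)).2 → (s i).1 v = (s k).1 v := by
    intro k i v hki hv
    induction i, hki using Nat.le_induction with
    | base => rfl
    | succ i hki ih =>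
      rw [hs₁, if_pos (hv.trans_le (hmono.monotone (Nat.succ_le_succ hki))), ih]
  have hagree : ∀ k, ∀ v < (s (k + 1)).2, (s v).1 v = (s k).1 v := by
    intro k v hv
    rcases le_total k v with hkv | hkv
    · exact hstable k v v hkv hv
    · exact (hstable v k v hkv (hmono.le_apply.trans_lt (hstep v).1)).symm
  refine ⟨fun v => (s v).1 v, fun k => ⟨(s k).1, (s k).2, (s (k + 1)).2, (hstep k).1, hconst k,
    (hstep k).2, hagree k, ?_⟩⟩
  change (s (s (k + 1)).2).1 (s (k + 1)).2 ≠ _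
  rw [hagree (k + 1) _ (hstep (k + 1)).1, hs₁, if_neg (lt_irrefl _)]
  simp

/-- any stopping-time/estimator scheme of density one which is eventually
a.s. correct for all finite order binary Markov chains must fail infinitely often, with
positive probability, on some stationary ergodic finitarily Markovian binary process. -/
theorem binary_finitarily_markovian_limitation
    (lam : ℕ → (ℕ → Bool) → ℕ) (h : ℕ → (ℕ → Bool) → ℕ)
    (hadapt : ∀ (n : ℕ) (x y : ℕ → Bool), (∀ i ≤ lam n x, x i = y i) → lam n x = lam n y)
    (hmono : ∀ (n : ℕ) (x : ℕ → Bool), lam n x < lam (n + 1) x)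
    (hmeas : ∀ (n : ℕ) (x y : ℕ → Bool), (∀ i ≤ lam n x, x i = y i) → h n x = h n y)
    (hcons : ∀ μ : Measure (ℤ → Bool), IsProbabilityMeasure μ → Ergodic (shift Bool) μ →
      (∃ L : ℕ, MarkovOfOrder μ L) →
      (∀ᵐ ω ∂μ, Tendsto
        (fun n : ℕ => (lam n (fun i : ℕ => ω (i : ℤ)) : ℝ) / n) atTop (nhds 1)) ∧
      (∀ᵐ ω ∂μ, ∀ᶠ n in atTop,
        h n (fun i : ℕ => ω (i : ℤ)) =
          memoryLenNat μ (proc Bool) (lam n (fun i : ℕ => ω (i : ℤ))) ω)) :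
    ∃ μ : Measure (ℤ → Bool), IsProbabilityMeasure μ ∧ Ergodic (shift Bool) μ ∧
      FinitarilyMarkovian μ (proc Bool) ∧
      0 < μ {ω | {n : ℕ | h n (fun i : ℕ => ω (i : ℤ)) ≠
        memoryLenNat μ (proc Bool) (lam n (fun i : ℕ => ω (i : ℤ))) ω}.Infinite} := by
  have hstage : ∀ k c m, (∀ v ≥ m, c v = c m) → ∃ m' > m, ∃ B : ℕ, B < 2 ^ m' ∧
      dyadicHaar (⋃ j ∈ Icc (-B : ℤ) (B + 1), {z | m' ≤ (z + j).valuation}) ≤ 2⁻¹ ^ k ∧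
      ∀ z, AvoidsZero z → ∃ n ≥ k, lam n (fun i : ℕ => path c z i) ≤ B ∧
        h n (fun i : ℕ => path c z i) ≤ B ∧
        (2 : ℤ_[2]) ^ m ∣ z + (lam n (fun i : ℕ => path c z i) : ℕ) + 1 := by
    intro k c m hc
    obtain ⟨B, hB⟩ := exists_uniform_bound lam h hmono hc
      (hcons (odoLaw c) inferInstance (ergodic_odoLaw c) (markovOfOrder_odoLaw hc)).1 k
    obtain ⟨m', hm, hBm, hle⟩ := exists_measure_valuation_ge_le m B
      (ε := 2⁻¹ ^ k) (ENNReal.pow_pos (by simp) k)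
    exact ⟨m', hm, B, hBm, hle, hB⟩
  obtain ⟨c, hc⟩ := exists_coloring _ hstage
  choose c' m m' hmm hconst hB hagree hflip using hc
  choose B hBm hle hB using hB
  refine ⟨odoLaw c, inferInstance, ergodic_odoLaw c, finitarilyMarkovian_odoLaw c, ?_⟩
  have hsum : ∑' k, dyadicHaar
      (⋃ j ∈ Icc (-(B k) : ℤ) (B k + 1), {z | m' k ≤ (z + j).valuation}) ≠ ⊤ := by
    refine ne_top_of_le_ne_top ?_ (ENNReal.tsum_le_tsum hle)
    rw [ENNReal.tsum_geometric]
    simp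
  have herr : ∀ᵐ z ∂dyadicHaar, {n : ℕ | h n (fun i : ℕ => path c z (i : ℤ)) ≠
      memoryLenNat (odoLaw c) (proc Bool) (lam n (fun i : ℕ => path c z (i : ℤ)))
        (path c z)}.Infinite := by
    filter_upwards [ae_avoidsZero, ae_eventually_notMem hsum] with z hz hgood
    refine Nat.frequently_atTop_iff_infinite.1 (frequently_atTop.2 fun N => ?_)
    obtain ⟨k, hk, hkN⟩ := (hgood.and (eventually_ge_atTop N)).exists
    have hwin : ∀ j : ℤ, -(B k : ℤ) ≤ j → j ≤ B k + 1 → (z + j).valuation < m' k := by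
      intro j h1 h2
      by_contra! hge
      exact hk (mem_iUnion₂.2 ⟨j, ⟨h1, h2⟩, hge⟩)
    obtain ⟨n, hn, h1, h2, h3⟩ := hB k z hz
    have hsame : ∀ i ≤ lam n (fun i : ℕ => path (c' k) z i), path (c' k) z i = path c z i :=
      fun i hi => (hagree k _ (hwin i (by omega) (by omega))).symm
    have hlam := hadapt n _ (fun i : ℕ => path c z i) hsame
    have hh := hmeas n _ (fun i : ℕ => path c z i) hsame
    rw [hlam] at h1 h3
    rw [hh] at h2
    refine ⟨n, hkN.trans hn, (h2.trans_lt ?_).ne⟩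
    exact lt_memoryLenNat_of_flip (hconst k) (hagree k) (hflip k) (hBm k) hz
      (fun j hj1 hj2 => hwin j (by omega) (by omega)) (hmm k).le (by exact_mod_cast h3)
  rw [pos_iff_ne_zero]
  intro hzero
  have hae := ae_of_ae_map (measurable_path c).aemeasurable (measure_eq_zero_iff_ae_notMem.1 hzero)
  obtain ⟨z, hz1, hz2⟩ := (herr.and hae).exists
  exact hz2 hz1

end MemoryEst
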